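/- Let O ⊆ ℝ^d be an open set and let δ, ω be positive Borel measures on O with compact support in O such that ω is an sbh(O)-balayage of δ, i.e. ∫ u dδ ≤ ∫ u dω for every u subharmonic on O. If E ⊆ ℝ^d is a polar set, then ω(O ∩ E ∖ supp δ) = 0. -/

import Mathlib

open MeasureTheory Metric Set Filter
open scoped ENNReal Topology OnePoint

noncomputable section

/-- `d`-dimensional Euclidean space. -/
abbrev Euc (d : ℕ) : Type := EuclideanSpace ℝ (Fin d)

/-- A real-valued function is *harmonic on a set* if it is continuous there and satisfies
the mean value equality over every closed ball contained in the set. -/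
def HarmOn {d : ℕ} (h : Euc d → ℝ) (O : Set (Euc d)) : Prop :=
  ContinuousOn h O ∧
    ∀ x : Euc d, ∀ r : ℝ, 0 < r → closedBall x r ⊆ O →
      h x = ⨍ y in closedBall x r, h y ∂volume

/-- An `EReal`-valued function is *subharmonic on a set* if it is upper semicontinuous there,
nowhere `+∞` there, and on every closed ball contained in the set it is dominated by each
continuous function harmonic in the interior that dominates it on the boundary sphere. -/
def SbhOn {d : ℕ} (u : Euc d → EReal) (O : Set (Euc d)) : Prop :=
  UpperSemicontinuousOn u O ∧ (∀ x ∈ O, u x < ⊤) ∧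
    ∀ x : Euc d, ∀ r : ℝ, 0 < r → closedBall x r ⊆ O →
      ∀ h : Euc d → ℝ, ContinuousOn h (closedBall x r) → HarmOn h (ball x r) →
        (∀ y ∈ sphere x r, u y ≤ (h y : EReal)) →
        ∀ y ∈ closedBall x r, u y ≤ (h y : EReal)

/-- The positive part of an extended real number, as a member of `ℝ≥0∞`. -/
def erealPos (x : EReal) : ℝ≥0∞ := if x = ⊤ then ⊤ else ENNReal.ofReal x.toReal

/-- The integral of an `EReal`-valued function against a measure, with values in `EReal`:
the lower integral of the positive part minus the lower integral of the negative part. -/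
def eInt {d : ℕ} (μ : Measure (Euc d)) (u : Euc d → EReal) : EReal :=
  ((∫⁻ x, erealPos (u x) ∂μ : ℝ≥0∞) : EReal) -
    ((∫⁻ x, erealPos (-(u x)) ∂μ : ℝ≥0∞) : EReal)

/-- The (closed) support of a measure: points all of whose open neighbourhoods
have strictly positive measure. -/
def msupp {d : ℕ} (μ : Measure (Euc d)) : Set (Euc d) :=
  {x | ∀ U : Set (Euc d), IsOpen U → x ∈ U → 0 < μ U}

/-- A finite positive Borel measure whose support is a compact subset of `O`. -/
def MeasCompIn {d : ℕ} (μ : Measure (Euc d)) (O : Set (Euc d)) : Prop :=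
  IsCompact (msupp μ) ∧ msupp μ ⊆ O ∧ μ (msupp μ)ᶜ = 0 ∧ μ Set.univ < ⊤

/-- The *inward filling* of `S` with respect to `O`: the union of `S` with all connected
components of `O \ S` that are relatively compact in `O`. -/
def infill {X : Type*} [TopologicalSpace X] (O S : Set X) : Set X :=
  S ∪ {y | ∃ x ∈ O \ S, y ∈ connectedComponentIn (O \ S) x ∧
      IsCompact (closure (connectedComponentIn (O \ S) x)) ∧
      closure (connectedComponentIn (O \ S) x) ⊆ O}

/-- A set `A ⊆ ℝ^d` is *polar* if there is a function subharmonic on all of `ℝ^d`,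
not identically `-∞`, which equals `-∞` on `A`. -/
def PolarSet {d : ℕ} (A : Set (Euc d)) : Prop :=
  ∃ u : Euc d → EReal, SbhOn u Set.univ ∧ (∃ x : Euc d, u x ≠ ⊥) ∧ A ⊆ {x | u x = ⊥}

section MeanValue

lemma lipschitzWith_one_sub_min_norm_sq {E : Type*} [SeminormedAddCommGroup E] :
    LipschitzWith 2 (fun y : E => 1 - (min ‖y‖ 1) ^ 2) := by
  refine LipschitzWith.of_dist_le_mul fun x y => ?_
  have h1 : |min ‖x‖ 1 - min ‖y‖ 1| ≤ dist x y :=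
    (abs_min_sub_min_le_max ‖x‖ 1 ‖y‖ 1).trans
      (by simpa [dist_eq_norm] using abs_norm_sub_norm_le x y)
  have hx0 : 0 ≤ min ‖x‖ 1 := by positivity
  have hy0 : 0 ≤ min ‖y‖ 1 := by positivity
  have h2 : |min ‖x‖ 1 + min ‖y‖ 1| ≤ 2 := by
    rw [abs_of_nonneg (by positivity)]
    linarith [min_le_right ‖x‖ 1, min_le_right ‖y‖ 1]
  calc dist (1 - (min ‖x‖ 1) ^ 2) (1 - (min ‖y‖ 1) ^ 2)
      = |min ‖x‖ 1 + min ‖y‖ 1| * |min ‖x‖ 1 - min ‖y‖ 1| := by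
        rw [Real.dist_eq, ← abs_mul, ← abs_neg]; congr 1; ring
    _ ≤ 2 * dist x y := by gcongr

/-- Integration by parts on the unit ball against the weight `1 - ‖y‖ ^ 2`, which vanishes on the
unit sphere. -/
lemma setIntegral_closedBall_inner_mul {d : ℕ} {g : Euc d → ℝ}
    (hg : ContDiff ℝ 1 g) (v : Euc d) :
    ∫ y in closedBall (0 : Euc d) 1, 2 * inner ℝ y v * g y =
      ∫ y in closedBall (0 : Euc d) 1, (1 - ‖y‖ ^ 2) * fderiv ℝ g y v := by
  let χ : ContDiffBump (0 : Euc d) := ⟨2, 3, by norm_num, by norm_num⟩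
  let G : Euc d → ℝ := fun y => 1 - (min ‖y‖ 1) ^ 2
  let k : Euc d → ℝ := fun y => χ y * g y
  have hkc : HasCompactSupport k := χ.hasCompactSupport.mul_right
  have hkd : ContDiff ℝ 1 k := χ.contDiff.mul hg
  obtain ⟨D, hkL⟩ := hkd.lipschitzWith_of_hasCompactSupport hkc (by simp)
  have key := LipschitzWith.integral_lineDeriv_mul_eq (μ := volume)
    (lipschitzWith_one_sub_min_norm_sq (E := Euc d)) hkL hkc v
  have hk : ∀ y ∈ closedBall (0 : Euc d) 1, k =ᶠ[𝓝 y] g := by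
    intro y hy
    have : y ∈ ball (0 : Euc d) 2 := closedBall_subset_ball (by norm_num) hy
    filter_upwards [χ.eventuallyEq_one_of_mem_ball this] with z hz
    simp [k, hz]
  have hleft : ∫ y, lineDeriv ℝ G y v * k y =
      -∫ y in closedBall (0 : Euc d) 1, 2 * inner ℝ y v * g y := by
    rw [← integral_indicator isClosed_closedBall.measurableSet, ← integral_neg]
    apply integral_congr_ae
    have hs : ∀ᵐ y : Euc d, y ∉ sphere (0 : Euc d) 1 :=
      measure_eq_zero_iff_ae_notMem.1 (Measure.addHaar_sphere_of_ne_zero _ _ one_ne_zero)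
    filter_upwards [hs] with y hy
    rw [mem_sphere_zero_iff_norm] at hy
    rcases lt_or_gt_of_ne hy with h | h
    · have hy' : y ∈ closedBall (0 : Euc d) 1 := by simpa using h.le
      have hev : G =ᶠ[𝓝 y] fun z => 1 - ‖z‖ ^ 2 := by
        filter_upwards [isOpen_ball.mem_nhds (show y ∈ ball (0 : Euc d) 1 by simpa using h)]
          with z hz
        have : ‖z‖ ≤ 1 := by simpa using (mem_ball.1 hz).le
        simp [G, min_eq_left this]
      have hd : HasFDerivAt G (-(2 • innerSL ℝ y)) y :=
        ((hasStrictFDerivAt_norm_sq y).hasFDerivAt.const_sub 1).congr_of_eventuallyEq hev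
      rw [indicator_of_mem hy', (hd.hasLineDerivAt v).lineDeriv, (hk y hy').eq_of_nhds]
      simp
    · have hy' : y ∉ closedBall (0 : Euc d) 1 := by simpa using h
      have hev : G =ᶠ[𝓝 y] fun z => 0 := by
        filter_upwards [isClosed_closedBall.isOpen_compl.mem_nhds hy'] with z hz
        have : 1 ≤ ‖z‖ := by simpa using (not_le.1 fun h => hz (by simpa using h)).le
        simp [G, min_eq_right this]
      have hd : HasFDerivAt G (0 : Euc d →L[ℝ] ℝ) y :=
        (hasFDerivAt_const 0 y).congr_of_eventuallyEq hev
      rw [indicator_of_notMem hy', (hd.hasLineDerivAt v).lineDeriv]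
      simp
  have hright : ∫ y, lineDeriv ℝ k y (-v) * G y =
      -∫ y in closedBall (0 : Euc d) 1, (1 - ‖y‖ ^ 2) * fderiv ℝ g y v := by
    rw [← integral_indicator isClosed_closedBall.measurableSet, ← integral_neg]
    congr 1
    ext y
    by_cases hy : y ∈ closedBall (0 : Euc d) 1
    · have hd : HasFDerivAt k (fderiv ℝ g y) y :=
        ((hg.differentiable (by simp)) y).hasFDerivAt.congr_of_eventuallyEq (hk y hy)
      have h1 : ‖y‖ ≤ 1 := by simpa using hy
      rw [indicator_of_mem hy, (hd.hasLineDerivAt (-v)).lineDeriv]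
      simp [G, min_eq_left h1, mul_comm]
    · have h1 : 1 ≤ ‖y‖ := by simpa using (not_le.1 fun h => hy (by simpa using h)).le
      rw [indicator_of_notMem hy]
      simp [G, min_eq_right h1]
  have h := hleft.symm.trans (key.trans hright)
  exact neg_injective h

end MeanValue

section PolynomialFunctions

variable {d : ℕ}

/-- The function on Euclidean space defined by a polynomial. -/
def polyFun (p : MvPolynomial (Fin d) ℝ) (x : Euc d) : ℝ := MvPolynomial.eval x.ofLp p

/-- The Laplace operator on polynomials. -/
def polyLap (d : ℕ) : MvPolynomial (Fin d) ℝ →ₗ[ℝ] MvPolynomial (Fin d) ℝ :=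
  ∑ i, (MvPolynomial.pderiv i).toLinearMap ∘ₗ (MvPolynomial.pderiv i).toLinearMap

lemma polyLap_apply (p : MvPolynomial (Fin d) ℝ) :
    polyLap d p = ∑ i, MvPolynomial.pderiv i (MvPolynomial.pderiv i p) := by
  simp [polyLap]

lemma contDiff_polyFun (p : MvPolynomial (Fin d) ℝ) {n : WithTop ℕ∞} :
    ContDiff ℝ n (polyFun p) := by
  induction p using MvPolynomial.induction_on with
  | C a =>
    have : polyFun (MvPolynomial.C a) = fun _ : Euc d => a := by ext x; simp [polyFun]
    rw [this]; exact contDiff_const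
  | add p q hp hq =>
    have : polyFun (p + q) = fun x => polyFun p x + polyFun q x := by
      ext x; simp [polyFun]
    rw [this]; exact hp.add hq
  | mul_X p i hp =>
    have : polyFun (p * MvPolynomial.X i) =
        fun x => polyFun p x * (EuclideanSpace.proj i : Euc d →L[ℝ] ℝ) x := by
      ext x; simp [polyFun]
    rw [this]; exact hp.mul (EuclideanSpace.proj i : Euc d →L[ℝ] ℝ).contDiff

lemma continuous_polyFun (p : MvPolynomial (Fin d) ℝ) : Continuous (polyFun p) :=
  (contDiff_polyFun p (n := 0)).continuous

lemma hasFDerivAt_polyFun (p : MvPolynomial (Fin d) ℝ) (x : Euc d) :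
    HasFDerivAt (polyFun p)
      (∑ i, polyFun (MvPolynomial.pderiv i p) x • (EuclideanSpace.proj i : Euc d →L[ℝ] ℝ)) x := by
  induction p using MvPolynomial.induction_on with
  | C a =>
    have : polyFun (MvPolynomial.C a) = fun _ : Euc d => a := by ext x; simp [polyFun]
    rw [this]
    exact (hasFDerivAt_const a x).congr_fderiv (by simp [polyFun])
  | add p q hp hq =>
    have : polyFun (p + q) = fun x => polyFun p x + polyFun q x := by
      ext x; simp [polyFun]
    rw [this]
    refine (hp.add hq).congr_fderiv ?_
    rw [← Finset.sum_add_distrib]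
    refine Finset.sum_congr rfl fun i _ => ?_
    simp [polyFun, add_smul]
  | mul_X p j hp =>
    have : polyFun (p * MvPolynomial.X j) =
        fun x => polyFun p x * (EuclideanSpace.proj j : Euc d →L[ℝ] ℝ) x := by
      ext x; simp [polyFun]
    rw [this]
    refine (hp.mul (EuclideanSpace.proj j : Euc d →L[ℝ] ℝ).hasFDerivAt).congr_fderiv ?_
    ext v
    simp [polyFun, MvPolynomial.pderiv_X, Pi.single_apply, add_mul,
      Finset.sum_add_distrib, Finset.mul_sum]
    congr 1
    · rw [Finset.sum_eq_single j]
      · simp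
      · intro b _ hb; simp [hb.symm]
      · simp
    · exact Finset.sum_congr rfl fun i _ => (mul_assoc _ _ _).symm

lemma setAverage_closedBall_eq_unit (f : Euc d → ℝ) (x : Euc d) {r : ℝ} (hr : 0 < r) :
    ⨍ y in closedBall x r, f y = ⨍ y in closedBall (0 : Euc d) 1, f (x + r • y) := by
  have h1 := Measure.setIntegral_comp_smul_of_pos (volume : Measure (Euc d))
    (fun y => f (x + y)) (closedBall (0 : Euc d) 1) hr
  have h2 := (measurePreserving_add_left (volume : Measure (Euc d)) x).setIntegral_preimage_emb
    (measurableEmbedding_addLeft x) f (closedBall x r)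
  rw [_root_.smul_closedBall _ _ zero_le_one] at h1
  have hpre : (fun y => x + y) ⁻¹' closedBall x r = closedBall (0 : Euc d) r := by
    ext y; simp
  rw [hpre] at h2
  simp only [smul_zero, Real.norm_of_nonneg hr.le, mul_one] at h1
  rw [setAverage_eq, setAverage_eq, h1, h2, smul_smul]
  congr 1
  rw [Measure.real, Measure.addHaar_closedBall _ _ hr.le, ENNReal.toReal_mul,
    ENNReal.toReal_ofReal (by positivity), mul_inv, mul_comm, Measure.real,
    Measure.addHaar_closedBall _ _ zero_le_one]
  simp

lemma hasDerivAt_integral_polyFun (p : MvPolynomial (Fin d) ℝ) (x : Euc d) (s : ℝ) :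
    HasDerivAt (fun s => ∫ y in closedBall (0 : Euc d) 1, polyFun p (x + s • y))
      (∫ y in closedBall (0 : Euc d) 1,
        ∑ i, polyFun (MvPolynomial.pderiv i p) (x + s • y) * y i) s := by
  let F' : ℝ → Euc d → ℝ := fun t y => ∑ i, polyFun (MvPolynomial.pderiv i p) (x + t • y) * y i
  have hc : ∀ q : MvPolynomial (Fin d) ℝ,
      Continuous fun z : ℝ × Euc d => polyFun q (x + z.1 • z.2) := fun q =>
    (continuous_polyFun q).comp (by fun_prop)
  have hcF' : Continuous fun z : ℝ × Euc d => F' z.1 z.2 := by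
    refine continuous_finsetSum _ fun i _ => (hc _).mul ?_
    fun_prop
  obtain ⟨C, hC⟩ := ((isCompact_Icc (a := s - 1) (b := s + 1)).prod
    (isCompact_closedBall (0 : Euc d) 1)).exists_bound_of_continuousOn hcF'.continuousOn
  refine (hasDerivAt_integral_of_dominated_loc_of_deriv_le (s := Icc (s - 1) (s + 1))
    (bound := fun _ => C) (F' := F')
    (Icc_mem_nhds (by linarith) (by linarith)) ?_ ?_ ?_ ?_ ?_ ?_).2
  · exact Eventually.of_forall fun t =>
      ((hc p).comp (by fun_prop : Continuous fun y : Euc d => (t, y))).aestronglyMeasurable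
  · exact (((hc p).comp (by fun_prop : Continuous fun y : Euc d => (s, y))).continuousOn
      ).integrableOn_compact (isCompact_closedBall _ _)
  · exact (hcF'.comp (by fun_prop : Continuous fun y : Euc d => (s, y))).aestronglyMeasurable
  · exact (ae_restrict_mem isClosed_closedBall.measurableSet).mono
      fun y hy t ht => hC (t, y) ⟨ht, hy⟩
  · exact (continuous_const.continuousOn).integrableOn_compact (isCompact_closedBall _ _)
  · refine Eventually.of_forall fun y t _ => ?_
    have h1 : HasDerivAt (fun t : ℝ => x + t • y) y t := by
      simpa using ((hasDerivAt_id t).smul_const y).const_add x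
    have h2 := (hasFDerivAt_polyFun p (x + t • y)).comp_hasDerivAt t h1
    simpa [F', Function.comp_def] using h2

/-- The derivative in the radius of the ball average vanishes for a harmonic polynomial. -/
lemma integral_closedBall_pderiv_eq_zero {p : MvPolynomial (Fin d) ℝ} (hp : polyLap d p = 0)
    (x : Euc d) (s : ℝ) :
    ∫ y in closedBall (0 : Euc d) 1,
      ∑ i, polyFun (MvPolynomial.pderiv i p) (x + s • y) * y i = 0 := by
  have hcont : ∀ q : MvPolynomial (Fin d) ℝ, ContDiff ℝ 1 fun y : Euc d => polyFun q (x + s • y) :=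
    fun q => (contDiff_polyFun q).comp (by fun_prop)
  have hint : ∀ f : Euc d → ℝ, Continuous f →
      Integrable f (volume.restrict (closedBall (0 : Euc d) 1)) := fun f hf =>
    hf.continuousOn.integrableOn_compact (isCompact_closedBall _ _)
  have hparts : ∀ i : Fin d,
      ∫ y in closedBall (0 : Euc d) 1, 2 * (polyFun (MvPolynomial.pderiv i p) (x + s • y) * y i) =
      ∫ y in closedBall (0 : Euc d) 1, s * ((1 - ‖y‖ ^ 2) *
        polyFun (MvPolynomial.pderiv i (MvPolynomial.pderiv i p)) (x + s • y)) := by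
    intro i
    have h := setIntegral_closedBall_inner_mul (hcont (MvPolynomial.pderiv i p))
      (EuclideanSpace.single i (1 : ℝ))
    convert h using 3 with y y
    · simp [EuclideanSpace.inner_single_right]
      ring
    · have h1 : HasFDerivAt (fun y : Euc d => x + s • y) (s • ContinuousLinearMap.id ℝ (Euc d)) y :=
        ((hasFDerivAt_id y).const_smul s).const_add x
      have h2 := ((hasFDerivAt_polyFun (MvPolynomial.pderiv i p) (x + s • y)).comp y h1).fderiv
      simp only [Function.comp_def] at h2
      rw [h2]
      simp
      ring
  have hc1 : ∀ i, Continuous fun y : Euc d =>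
      2 * (polyFun (MvPolynomial.pderiv i p) (x + s • y) * y i) := fun i =>
    continuous_const.mul ((hcont _).continuous.mul (by fun_prop))
  have hc2 : ∀ i, Continuous fun y : Euc d => s * ((1 - ‖y‖ ^ 2) *
      polyFun (MvPolynomial.pderiv i (MvPolynomial.pderiv i p)) (x + s • y)) := fun i =>
    continuous_const.mul (Continuous.mul (by fun_prop) (hcont _).continuous)
  have h2 : 2 * ∫ y in closedBall (0 : Euc d) 1,
      ∑ i, polyFun (MvPolynomial.pderiv i p) (x + s • y) * y i = 0 := by
    rw [← integral_const_mul]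
    simp_rw [Finset.mul_sum]
    rw [integral_finsetSum _ fun i _ => hint _ (hc1 i)]
    simp_rw [hparts]
    rw [← integral_finsetSum _ fun i _ => hint _ (hc2 i)]
    have hz : ∀ y : Euc d, ∑ i, s * ((1 - ‖y‖ ^ 2) *
        polyFun (MvPolynomial.pderiv i (MvPolynomial.pderiv i p)) (x + s • y)) = 0 := by
      intro y
      rw [← Finset.mul_sum, ← Finset.mul_sum]
      have : ∑ i, polyFun (MvPolynomial.pderiv i (MvPolynomial.pderiv i p)) (x + s • y) = 0 := by
        have h := congrArg (MvPolynomial.eval (x + s • y).ofLp) hp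
        rw [polyLap_apply, map_sum, map_zero] at h
        exact h
      rw [this]; simp
    simp [hz]
  linarith

lemma harmOn_polyFun {p : MvPolynomial (Fin d) ℝ} (hp : polyLap d p = 0) (O : Set (Euc d)) :
    HarmOn (polyFun p) O := by
  refine ⟨(continuous_polyFun p).continuousOn, fun x r hr _ => ?_⟩
  have hconst := is_const_of_deriv_eq_zero
    (fun s => (hasDerivAt_integral_polyFun p x s).differentiableAt)
    (fun s => (hasDerivAt_integral_polyFun p x s).deriv.trans
      (integral_closedBall_pderiv_eq_zero hp x s)) r 0
  rw [setAverage_closedBall_eq_unit _ _ hr, setAverage_eq, hconst, ← setAverage_eq]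
  simp only [zero_smul, add_zero]
  rw [setAverage_const (measure_closedBall_pos _ _ one_pos).ne' measure_closedBall_lt_top.ne]

end PolynomialFunctions

section HarmonicOn

variable {d : ℕ}

lemma HarmOn.mono {h : Euc d → ℝ} {U V : Set (Euc d)} (hh : HarmOn h V) (hUV : U ⊆ V) :
    HarmOn h U :=
  ⟨hh.1.mono hUV, fun x r hr hx => hh.2 x r hr (hx.trans hUV)⟩

lemma harmOn_const (a : ℝ) (U : Set (Euc d)) : HarmOn (fun _ => a) U :=
  ⟨continuousOn_const, fun x _ hr _ =>
    (setAverage_const (measure_closedBall_pos _ x hr).ne' measure_closedBall_lt_top.ne a).symm⟩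

lemma HarmOn.const_mul {h : Euc d → ℝ} {U : Set (Euc d)} (hh : HarmOn h U) (a : ℝ) :
    HarmOn (fun y => a * h y) U := by
  refine ⟨continuousOn_const.mul hh.1, fun x r hr hx => ?_⟩
  simp only [hh.2 x r hr hx, setAverage_eq, integral_const_mul, smul_eq_mul]
  ring

lemma HarmOn.sub {f g : Euc d → ℝ} {U : Set (Euc d)} (hf : HarmOn f U) (hg : HarmOn g U) :
    HarmOn (fun y => f y - g y) U := by
  refine ⟨hf.1.sub hg.1, fun x r hr hx => ?_⟩
  have hif := (hf.1.mono hx).integrableOn_compact (μ := volume) (isCompact_closedBall x r)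
  have hig := (hg.1.mono hx).integrableOn_compact (μ := volume) (isCompact_closedBall x r)
  simp only [hf.2 x r hr hx, hg.2 x r hr hx, setAverage_eq]
  rw [integral_sub hif hig, smul_sub]

/-- The mean value equality as an equality of integrals. -/
lemma HarmOn.measureReal_mul_eq {h : Euc d → ℝ} {U : Set (Euc d)} (hh : HarmOn h U) {x : Euc d}
    {r : ℝ} (hr : 0 < r) (hx : closedBall x r ⊆ U) :
    (volume : Measure (Euc d)).real (closedBall x r) * h x = ∫ y in closedBall x r, h y := by
  have hpos : 0 < (volume : Measure (Euc d)).real (closedBall x r) :=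
    ENNReal.toReal_pos (measure_closedBall_pos _ x hr).ne' measure_closedBall_lt_top.ne
  rw [hh.2 x r hr hx, setAverage_eq, smul_eq_mul, mul_inv_cancel_left₀ hpos.ne']

lemma HarmOn.eqOn_ball_of_le {h : Euc d → ℝ} {U : Set (Euc d)} (hh : HarmOn h U) {x : Euc d}
    {r : ℝ} (hr : 0 < r) (hx : closedBall x r ⊆ U) (hle : ∀ y ∈ closedBall x r, h y ≤ h x) :
    EqOn h (fun _ => h x) (ball x r) := by
  have hc : ContinuousOn (fun y => h x - h y) (closedBall x r) :=
    continuousOn_const.sub (hh.1.mono hx)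
  have hi := hc.integrableOn_compact (μ := volume) (isCompact_closedBall x r)
  have hih := (hh.1.mono hx).integrableOn_compact (μ := volume) (isCompact_closedBall x r)
  have hzero : ∫ y in closedBall x r, (h x - h y) = 0 := by
    have hic : IntegrableOn (fun _ : Euc d => h x) (closedBall x r) :=
      integrableOn_const measure_closedBall_lt_top.ne
    rw [integral_sub hic hih, ← hh.measureReal_mul_eq hr hx]
    simp
  have hae := (setIntegral_eq_zero_iff_of_nonneg_ae
    ((ae_restrict_mem isClosed_closedBall.measurableSet).mono
      fun y hy => sub_nonneg.2 (hle y hy)) hi).1 hzero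
  have hae' : (fun y => h x - h y) =ᵐ[volume.restrict (ball x r)] fun _ => 0 :=
    ae_restrict_of_ae_restrict_of_subset ball_subset_closedBall hae
  have heq := Measure.eqOn_open_of_ae_eq hae' isOpen_ball (hc.mono ball_subset_closedBall)
    continuousOn_const
  exact fun y hy => (sub_eq_zero.1 (heq hy)).symm

/-- The maximum principle. -/
lemma HarmOn.le_of_le_boundary (hd : d ≠ 0) {g : Euc d → ℝ} {K W : Set (Euc d)} {M : ℝ}
    (hK : IsCompact K) (hW : IsOpen W) (hWK : W ⊆ K) (hgK : ContinuousOn g K) (hg : HarmOn g W)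
    (hb : ∀ y ∈ K \ W, g y ≤ M) {y : Euc d} (hy : y ∈ K) : g y ≤ M := by
  obtain ⟨z₀, hz₀, hmax⟩ := hK.exists_isMaxOn ⟨y, hy⟩ hgK
  refine (hmax hy).trans ?_
  by_contra! hlt
  let i : Fin d := ⟨0, Nat.pos_of_ne_zero hd⟩
  have hZ : IsCompact (K ∩ g ⁻¹' Ici (g z₀)) :=
    hK.of_isClosed_subset (hgK.preimage_isClosed_of_isClosed hK.isClosed isClosed_Ici)
      inter_subset_left
  obtain ⟨z, ⟨hzK, hz⟩, hzmax⟩ := hZ.exists_isMaxOn ⟨z₀, hz₀, le_refl (g z₀)⟩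
    (f := fun x : Euc d => x i) (by fun_prop)
  have hgz : g z = g z₀ := le_antisymm (hmax hzK) hz
  have hzW : z ∈ W := by
    by_contra h
    linarith [hb z ⟨hzK, h⟩]
  obtain ⟨r, hr, hrW⟩ := nhds_basis_closedBall.mem_iff.1 (hW.mem_nhds hzW)
  have heq := hg.eqOn_ball_of_le hr hrW fun x hx => hgz ▸ hmax (hWK (hrW hx))
  have hmem : z + EuclideanSpace.single i (r / 2) ∈ ball z r := by
    simp [abs_of_pos hr]
    linarith
  have h1 : (z + EuclideanSpace.single i (r / 2)) i ≤ z i :=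
    hzmax ⟨hWK (hrW (ball_subset_closedBall hmem)), ((heq hmem).trans hgz).ge⟩
  simp at h1
  linarith

/-- A comparison form of the maximum principle on a closed ball. -/
lemma HarmOn.le_of_le_sphere (hd : d ≠ 0) {f g : Euc d → ℝ} {c : Euc d} {R : ℝ}
    (hfc : ContinuousOn f (closedBall c R)) (hf : HarmOn f (ball c R))
    (hgc : ContinuousOn g (closedBall c R)) (hg : HarmOn g (ball c R)) {M : ℝ}
    (hb : ∀ y ∈ sphere c R, f y ≤ g y + M) {y : Euc d} (hy : y ∈ closedBall c R) :
    f y ≤ g y + M := by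
  have := HarmOn.le_of_le_boundary (M := M) hd (isCompact_closedBall c R) isOpen_ball
    ball_subset_closedBall (hfc.sub hgc) (hf.sub hg)
    (fun z hz => by
      have : z ∈ sphere c R := by rwa [closedBall_sdiff_ball] at hz
      exact sub_le_iff_le_add'.2 (hb z this)) hy
  exact sub_le_iff_le_add'.1 this

/-- Harnack's inequality for points whose mutual distance is small. -/
lemma HarmOn.harnack {h : Euc d → ℝ} {c : Euc d} {R : ℝ} (hR : 0 < R)
    (hh : HarmOn h (ball c R)) (hnn : ∀ y ∈ ball c R, 0 ≤ h y) {x p : Euc d}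
    (hx : x ∈ ball c (R / 8)) (hp : p ∈ ball c (R / 8)) : h x ≤ 2 ^ d * h p := by
  rw [mem_ball] at hx hp
  have hxp : dist x p ≤ R / 4 := by linarith [dist_triangle_right x p c]
  have hsub : closedBall x (R / 4) ⊆ closedBall p (R / 2) :=
    closedBall_subset_closedBall' (by linarith)
  have hpB : closedBall p (R / 2) ⊆ ball c R := closedBall_subset_ball' (by linarith)
  have hi := (hh.1.mono hpB).integrableOn_compact (μ := volume) (isCompact_closedBall _ _)
  have hmono : ∫ y in closedBall x (R / 4), h y ≤ ∫ y in closedBall p (R / 2), h y :=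
    setIntegral_mono_set hi
      ((ae_restrict_mem isClosed_closedBall.measurableSet).mono fun y hy => hnn y (hpB hy))
      hsub.eventuallyLE
  rw [← hh.measureReal_mul_eq (by positivity) hpB,
    ← hh.measureReal_mul_eq (by positivity) (hsub.trans hpB)] at hmono
  have hvol : (volume : Measure (Euc d)).real (closedBall p (R / 2)) =
      2 ^ d * (volume : Measure (Euc d)).real (closedBall x (R / 4)) := by
    simp only [Measure.real]
    rw [Measure.addHaar_closedBall _ _ (by positivity),
      Measure.addHaar_closedBall _ _ (by positivity),
      ENNReal.toReal_mul, ENNReal.toReal_mul, ENNReal.toReal_ofReal (by positivity),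
      ENNReal.toReal_ofReal (by positivity), ← mul_assoc, finrank_euclideanSpace_fin, ← mul_pow]
    congr 2
    ring
  have hpos : 0 < (volume : Measure (Euc d)).real (closedBall x (R / 4)) :=
    ENNReal.toReal_pos (measure_closedBall_pos _ x (by positivity)).ne' measure_closedBall_lt_top.ne
  rw [hvol, mul_assoc, mul_left_comm] at hmono
  exact le_of_mul_le_mul_left hmono hpos

lemma harmOn_of_tendstoUniformlyOn {F : ℕ → Euc d → ℝ} {f : Euc d → ℝ} {U : Set (Euc d)}
    (hF : ∀ n, HarmOn (F n) U) (hlim : TendstoUniformlyOn F f atTop U) : HarmOn f U := by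
  have hfc : ContinuousOn f U := hlim.continuousOn (Frequently.of_forall fun n => (hF n).1)
  refine ⟨hfc, fun x r hr hx => ?_⟩
  have hi := (hfc.mono hx).integrableOn_compact (μ := volume) (isCompact_closedBall x r)
  have hiF := fun n => ((hF n).1.mono hx).integrableOn_compact (μ := volume)
    (isCompact_closedBall x r)
  have hpt : Tendsto (fun n => F n x) atTop (𝓝 (f x)) :=
    hlim.tendsto_at (hx (mem_closedBall_self hr.le))
  refine tendsto_nhds_unique hpt ?_
  have hint : Tendsto (fun n => ∫ y in closedBall x r, F n y) atTop
      (𝓝 (∫ y in closedBall x r, f y)) := by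
    rw [Metric.tendstoUniformlyOn_iff] at hlim
    refine tendsto_integral_filter_of_dominated_convergence (fun y => ‖f y‖ + 1)
      (Eventually.of_forall fun n => (hiF n).aestronglyMeasurable) ?_
      (hi.norm.add (integrableOn_const measure_closedBall_lt_top.ne)) ?_
    · filter_upwards [hlim 1 one_pos] with n hn
      filter_upwards [ae_restrict_mem isClosed_closedBall.measurableSet] with y hy
      have := hn y (hx hy)
      rw [dist_comm, dist_eq_norm] at this
      linarith [norm_sub_norm_le (F n y) (f y)]
    · filter_upwards [ae_restrict_mem isClosed_closedBall.measurableSet] with y hy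
      exact (Metric.tendstoUniformlyOn_iff.2 hlim).tendsto_at (hx hy)
  have := hint.const_smul ((volume : Measure (Euc d)).real (closedBall x r))⁻¹
  rw [setAverage_eq]
  refine this.congr fun n => ?_
  rw [(hF n).2 x r hr hx, setAverage_eq]

end HarmonicOn

section Dirichlet

variable {d : ℕ}

lemma totalDegree_pderiv_le {σ R : Type*} [CommSemiring R] (i : σ) (p : MvPolynomial σ R) :
    (MvPolynomial.pderiv i p).totalDegree ≤ p.totalDegree - 1 := by
  classical
  conv_lhs => rw [p.as_sum]
  rw [map_sum]
  refine (MvPolynomial.totalDegree_finsetSum _ _).trans (Finset.sup_le fun s hs => ?_)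
  rw [MvPolynomial.pderiv_monomial]
  by_cases hsi : s i = 0
  · simp [hsi]
  · refine (MvPolynomial.totalDegree_monomial_le _ _).trans ?_
    have hdeg : s.degree ≤ p.totalDegree := MvPolynomial.le_totalDegree hs
    have hle : Finsupp.single i 1 ≤ s := by
      simpa [Finsupp.single_le_iff] using Nat.one_le_iff_ne_zero.2 hsi
    have hadd : (s - Finsupp.single i 1).degree + 1 = s.degree := by
      conv_rhs => rw [← tsub_add_cancel_of_le hle]
      simp
    have : ((s - Finsupp.single i 1).sum fun _ => id) = (s - Finsupp.single i 1).degree := rfl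
    omega

lemma totalDegree_polyLap_le (p : MvPolynomial (Fin d) ℝ) :
    (polyLap d p).totalDegree ≤ p.totalDegree - 2 := by
  rw [polyLap_apply]
  refine (MvPolynomial.totalDegree_finsetSum _ _).trans (Finset.sup_le fun i _ => ?_)
  have h1 := totalDegree_pderiv_le i (MvPolynomial.pderiv i p)
  have h2 := totalDegree_pderiv_le i p
  omega

/-- The polynomial `R ^ 2 - ‖x - c‖ ^ 2`. -/
def ballPoly (c : Euc d) (R : ℝ) : MvPolynomial (Fin d) ℝ :=
  MvPolynomial.C (R ^ 2) - ∑ i, (MvPolynomial.X i - MvPolynomial.C (c i)) ^ 2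

lemma polyFun_ballPoly (c : Euc d) (R : ℝ) (x : Euc d) :
    polyFun (ballPoly c R) x = R ^ 2 - dist x c ^ 2 := by
  rw [EuclideanSpace.dist_eq, Real.sq_sqrt (by positivity)]
  simp [polyFun, ballPoly, Real.dist_eq]

lemma totalDegree_ballPoly_le (c : Euc d) (R : ℝ) : (ballPoly c R).totalDegree ≤ 2 := by
  refine (MvPolynomial.totalDegree_sub _ _).trans (max_le
    ((MvPolynomial.totalDegree_C _).le.trans (by norm_num)) ?_)
  refine (MvPolynomial.totalDegree_finsetSum _ _).trans (Finset.sup_le fun i _ => ?_)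
  refine (MvPolynomial.totalDegree_pow _ _).trans ?_
  have : (MvPolynomial.X i - MvPolynomial.C (c i) : MvPolynomial (Fin d) ℝ).totalDegree ≤ 1 :=
    (MvPolynomial.totalDegree_sub _ _).trans (max_le (by simp) (by simp))
  omega

lemma eq_zero_of_polyFun_eq_zero {p : MvPolynomial (Fin d) ℝ} {c : Euc d} {R : ℝ} (hR : 0 < R)
    (hp : ∀ x ∈ ball c R, polyFun p x = 0) : p = 0 := by
  have hopen : IsOpen {y : Fin d → ℝ | (WithLp.toLp 2 y : Euc d) ∈ ball c R} :=
    isOpen_ball.preimage (PiLp.continuous_toLp 2 _)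
  obtain ⟨ε, hε, hsub⟩ := Metric.isOpen_iff.1 hopen c.ofLp (by simpa using hR)
  rw [ball_pi _ hε] at hsub
  refine MvPolynomial.funext_set (fun i => ball (c i) ε) (fun i => ?_) fun x hx => ?_
  · rw [Real.ball_eq_Ioo]
    exact Ioo_infinite (by linarith)
  · simpa [polyFun] using hp _ (hsub hx)

/-- Every polynomial agrees on a sphere with a harmonic polynomial. -/
lemma exists_polyLap_eq_zero (hd : d ≠ 0) (c : Euc d) {R : ℝ} (hR : 0 < R)
    (p : MvPolynomial (Fin d) ℝ) :
    ∃ h : MvPolynomial (Fin d) ℝ, polyLap d h = 0 ∧ ∀ x ∈ sphere c R, polyFun h x = polyFun p x := by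
  have hsphere : ∀ (q : MvPolynomial (Fin d) ℝ), ∀ x ∈ sphere c R,
      polyFun (ballPoly c R * q) x = 0 := by
    intro q x hx
    have : polyFun (ballPoly c R * q) x = polyFun (ballPoly c R) x * polyFun q x := by
      simp [polyFun]
    rw [this, polyFun_ballPoly, mem_sphere.1 hx]
    simp
  let V := MvPolynomial.restrictTotalDegree (Fin d) ℝ p.totalDegree
  let A : MvPolynomial (Fin d) ℝ →ₗ[ℝ] MvPolynomial (Fin d) ℝ :=
    polyLap d ∘ₗ LinearMap.mulLeft ℝ (ballPoly c R)
  have hA : ∀ q ∈ V, A q ∈ V := by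
    intro q hq
    rw [MvPolynomial.mem_restrictTotalDegree] at hq ⊢
    have h1 := totalDegree_polyLap_le (ballPoly c R * q)
    have h2 := MvPolynomial.totalDegree_mul (ballPoly c R) q
    have h3 := totalDegree_ballPoly_le c R
    change (polyLap d (ballPoly c R * q)).totalDegree ≤ _
    omega
  have hinj : Function.Injective (A.restrict hA) := by
    rw [injective_iff_map_eq_zero]
    intro q hq
    have hq0 : polyLap d (ballPoly c R * q) = 0 := congrArg Subtype.val hq
    have hh := harmOn_polyFun hq0 (ball c R)
    have hcont := (continuous_polyFun (ballPoly c R * (q : MvPolynomial (Fin d) ℝ))).continuousOn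
      (s := closedBall c R)
    have h0 := harmOn_const (d := d) 0 (ball c R)
    have hzero : ballPoly c R * (q : MvPolynomial (Fin d) ℝ) = 0 := by
      refine eq_zero_of_polyFun_eq_zero (c := c) hR fun x hx => ?_
      have hx' := ball_subset_closedBall hx
      have h1 := HarmOn.le_of_le_sphere hd hcont hh continuousOn_const h0 (M := 0)
        (fun y hy => by simp [hsphere _ y hy]) hx'
      have h2 := HarmOn.le_of_le_sphere hd continuousOn_const h0 hcont hh (M := 0)
        (fun y hy => by simp [hsphere _ y hy]) hx'
      simp only [add_zero] at h1 h2
      exact le_antisymm h1 h2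
    rcases mul_eq_zero.1 hzero with h | h
    · have := polyFun_ballPoly c R c
      rw [h] at this
      simp [polyFun] at this
      exact absurd this.symm (pow_ne_zero 2 hR.ne')
    · exact Subtype.ext h
  have hpV : polyLap d p ∈ V := by
    rw [MvPolynomial.mem_restrictTotalDegree]
    have := totalDegree_polyLap_le p
    omega
  obtain ⟨q, hq⟩ := LinearMap.injective_iff_surjective.1 hinj ⟨polyLap d p, hpV⟩
  have hq' : polyLap d (ballPoly c R * q) = polyLap d p := congrArg Subtype.val hq
  refine ⟨p - ballPoly c R * q, by rw [map_sub, hq', sub_self], fun x hx => ?_⟩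
  have : polyFun (p - ballPoly c R * (q : MvPolynomial (Fin d) ℝ)) x =
      polyFun p x - polyFun (ballPoly c R * (q : MvPolynomial (Fin d) ℝ)) x := by
    simp [polyFun]
  rw [this, hsphere _ x hx, sub_zero]

lemma exists_polyFun_near {K : Set (Euc d)} (hK : IsCompact K) (f : C(Euc d, ℝ)) {ε : ℝ}
    (hε : 0 < ε) :
    ∃ p : MvPolynomial (Fin d) ℝ, ∀ x ∈ K, |polyFun p x - f x| < ε := by
  let φ : MvPolynomial (Fin d) ℝ →ₐ[ℝ] C(Euc d, ℝ) :=
    MvPolynomial.aeval fun i => ⟨fun x => x i, by fun_prop⟩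
  have hφ : ∀ p x, φ p x = polyFun p x := by
    intro p x
    induction p using MvPolynomial.induction_on with
    | C a => simp [φ, polyFun, algebraMap_apply]
    | add p q hp hq => simpa [polyFun] using congrArg₂ (· + ·) hp hq
    | mul_X p i hp =>
      rw [map_mul, ContinuousMap.mul_apply, hp]
      simp [φ, polyFun]
  have hsep : φ.range.SeparatesPoints := by
    intro x y hxy
    obtain ⟨i, hi⟩ : ∃ i, x i ≠ y i := by
      by_contra! h
      exact hxy (PiLp.ext h)
    exact ⟨_, ⟨φ (MvPolynomial.X i), ⟨_, rfl⟩, rfl⟩, by simpa [φ] using hi⟩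
  obtain ⟨g, ⟨p, rfl⟩, hg⟩ :=
    ContinuousMap.exists_mem_subalgebra_near_continuous_of_isCompact_of_separatesPoints
      hsep f hK hε
  exact ⟨p, fun x hx => by simpa [hφ] using hg x hx⟩

/-- Solvability of the Dirichlet problem on a ball. -/
lemma exists_harmOn_eqOn_sphere (hd : d ≠ 0) (c : Euc d) {R : ℝ} (hR : 0 < R) {f : Euc d → ℝ}
    (hf : ContinuousOn f (sphere c R)) :
    ∃ g : Euc d → ℝ, ContinuousOn g (closedBall c R) ∧ HarmOn g (ball c R) ∧
      EqOn g f (sphere c R) := by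
  obtain ⟨f', hf'⟩ := ContinuousMap.exists_restrict_eq isClosed_sphere
    (⟨(sphere c R).domRestrict f, hf.domRestrict⟩ : C(sphere c R, ℝ))
  have hff' : ∀ x ∈ sphere c R, f' x = f x := fun x hx =>
    DFunLike.congr_fun hf' ⟨x, hx⟩
  have happrox : ∀ n : ℕ, ∃ h : MvPolynomial (Fin d) ℝ, polyLap d h = 0 ∧
      ∀ x ∈ sphere c R, |polyFun h x - f x| < 1 / (n + 1) := by
    intro n
    obtain ⟨p, hp⟩ := exists_polyFun_near (isCompact_sphere c R) f'
      (Nat.one_div_pos_of_nat (α := ℝ) (n := n))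
    obtain ⟨h, h0, hh⟩ := exists_polyLap_eq_zero hd c hR p
    exact ⟨h, h0, fun x hx => by rw [hh x hx, ← hff' x hx]; exact hp x hx⟩
  choose h h0 hh using happrox
  have hharm : ∀ n, HarmOn (polyFun (h n)) (ball c R) := fun n => harmOn_polyFun (h0 n) _
  have hcont : ∀ n, ContinuousOn (polyFun (h n)) (closedBall c R) := fun n =>
    (continuous_polyFun _).continuousOn
  have hdiff : ∀ m n, ∀ x ∈ closedBall c R,
      polyFun (h m) x ≤ polyFun (h n) x + (1 / ((m : ℝ) + 1) + 1 / ((n : ℝ) + 1)) := fun m n x hx =>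
    HarmOn.le_of_le_sphere hd (hcont m) (hharm m) (hcont n) (hharm n) (fun y hy => by
      have h1 := (abs_lt.1 (hh m y hy)).2
      have h2 := (abs_lt.1 (hh n y hy)).1
      linarith) hx
  have hcauchy : UniformCauchySeqOn (fun n => polyFun (h n)) atTop (closedBall c R) := by
    rw [Metric.uniformCauchySeqOn_iff]
    intro ε hε
    obtain ⟨N, hN⟩ := exists_nat_one_div_lt (half_pos hε)
    refine ⟨N, fun m hm n hn x hx => ?_⟩
    have h1 := hdiff m n x hx
    have h2 := hdiff n m x hx
    have h3 : 1 / ((m : ℝ) + 1) ≤ 1 / ((N : ℝ) + 1) := Nat.one_div_le_one_div hm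
    have h4 : 1 / ((n : ℝ) + 1) ≤ 1 / ((N : ℝ) + 1) := Nat.one_div_le_one_div hn
    rw [Real.dist_eq, abs_lt]
    constructor <;> linarith
  have hlim : ∀ x, ∃ y, x ∈ closedBall c R → Tendsto (fun n => polyFun (h n) x) atTop (𝓝 y) := by
    intro x
    by_cases hx : x ∈ closedBall c R
    · obtain ⟨y, hy⟩ := cauchySeq_tendsto_of_complete (hcauchy.cauchySeq hx)
      exact ⟨y, fun _ => hy⟩
    · exact ⟨0, fun h => absurd h hx⟩
  choose g hg using hlim
  have hunif : TendstoUniformlyOn (fun n => polyFun (h n)) g atTop (closedBall c R) :=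
    hcauchy.tendstoUniformlyOn_of_tendsto fun x hx => hg x hx
  refine ⟨g, hunif.continuousOn (Frequently.of_forall hcont),
    harmOn_of_tendstoUniformlyOn hharm (hunif.mono ball_subset_closedBall), fun x hx => ?_⟩
  refine tendsto_nhds_unique (hg x (sphere_subset_closedBall hx)) ?_
  rw [tendsto_iff_dist_tendsto_zero]
  exact squeeze_zero (fun _ => dist_nonneg)
    (fun n => by rw [Real.dist_eq]; exact (hh n x hx).le) tendsto_one_div_add_atTop_nhds_zero_nat

end Dirichlet

section Subharmonic

variable {d : ℕ} {u : Euc d → EReal}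

lemma SbhOn.mono {U V : Set (Euc d)} (hu : SbhOn u V) (hUV : U ⊆ V) : SbhOn u U :=
  ⟨hu.1.mono hUV, fun x hx => hu.2.1 x (hUV hx), fun x r hr hx => hu.2.2 x r hr (hx.trans hUV)⟩

lemma SbhOn.exists_forall_le (hu : SbhOn u univ) {K : Set (Euc d)} (hK : IsCompact K) :
    ∃ M : ℝ, ∀ y ∈ K, u y ≤ M := by
  rcases K.eq_empty_or_nonempty with rfl | hne
  · exact ⟨0, by simp⟩
  obtain ⟨a, _, hmax⟩ := (hu.1.mono (subset_univ K)).exists_isMaxOn hne hK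
  exact ⟨(u a).toReal, fun y hy =>
    (hmax hy).trans (EReal.le_coe_toReal (hu.2.1 a (mem_univ a)).ne)⟩

lemma SbhOn.dim_ne_zero (hu : SbhOn u univ) (hne : ∃ x, u x ≠ ⊥) : d ≠ 0 := by
  rintro rfl
  obtain ⟨x, hx⟩ := hne
  refine hx (EReal.eq_bot_iff_forall_lt _ |>.2 fun t => ?_)
  have h := hu.2.2 x 1 one_pos (subset_univ _) (fun _ => t - 1) continuousOn_const
    (harmOn_const _ _) (fun y hy => by
      have : dist y x = 0 := by rw [Subsingleton.elim y x, dist_self]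
      rw [mem_sphere, this] at hy
      norm_num at hy) x (mem_closedBall_self zero_le_one)
  exact h.trans_lt (by exact_mod_cast sub_one_lt t)

/-- A harmonic function on a ball, continuous up to the boundary, that is nonnegative on the
sphere and positive somewhere on it, is positive at the centre. -/
lemma HarmOn.pos_center (hd : d ≠ 0) {g : Euc d → ℝ} {x a : Euc d} {R : ℝ} (hR : 0 < R)
    (hgc : ContinuousOn g (closedBall x R)) (hg : HarmOn g (ball x R))
    (hnn : ∀ y ∈ sphere x R, 0 ≤ g y) (ha : a ∈ sphere x R) (hga : 0 < g a) : 0 < g x := by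
  have hnn' : ∀ y ∈ closedBall x R, 0 ≤ g y := fun y hy => by
    simpa using HarmOn.le_of_le_sphere (M := 0) hd continuousOn_const (harmOn_const 0 _) hgc hg
      (by simpa using hnn) hy
  by_contra! hgx
  have hneg := (harmOn_const 0 (ball x R)).sub hg
  have hzero : EqOn g (fun _ => 0) (ball x R) := by
    intro y hy
    obtain ⟨s, hys, hsR⟩ := exists_between (mem_ball.1 hy)
    have hsub : closedBall x s ⊆ ball x R := closedBall_subset_ball hsR
    have := hneg.eqOn_ball_of_le (dist_nonneg.trans_lt hys) hsub
      (fun z hz => by linarith [hnn' z (ball_subset_closedBall (hsub hz))]) (mem_ball.2 hys)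
    have := hnn' y (ball_subset_closedBall hy)
    simp only at *
    linarith
  have := hzero.of_subset_closure hgc continuousOn_const ball_subset_closedBall
    (closure_ball x hR.ne').ge (sphere_subset_closedBall ha)
  simp only at this
  linarith

lemma SbhOn.exists_mem_ball_ne_bot (hu : SbhOn u univ) (hne : ∃ x, u x ≠ ⊥) (a : Euc d) {ρ : ℝ}
    (hρ : 0 < ρ) : ∃ p ∈ ball a ρ, u p ≠ ⊥ := by
  have hd := hu.dim_ne_zero hne
  by_contra! hbot
  obtain ⟨x, hx⟩ := hne
  refine hx (EReal.eq_bot_iff_forall_lt _ |>.2 fun t => ?_)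
  have hxa : x ≠ a := by
    rintro rfl
    exact hx (hbot x (mem_ball_self hρ))
  have hR : 0 < dist a x := dist_pos.2 hxa.symm
  obtain ⟨g, hgc, hg, hgs⟩ := exists_harmOn_eqOn_sphere hd x hR
    (f := fun y => max 0 (ρ - dist y a)) (by fun_prop)
  have hgx : 0 < g x := HarmOn.pos_center hd hR hgc hg
    (fun y hy => (hgs hy).symm ▸ le_max_left _ _) (mem_sphere.2 rfl)
    ((hgs (mem_sphere.2 rfl)).symm ▸ by simp [hρ])
  obtain ⟨M, hM⟩ := hu.exists_forall_le (isCompact_sphere x (dist a x))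
  obtain ⟨n, hn⟩ := exists_nat_gt ((M - t) / g x)
  have h := hu.2.2 x _ hR (subset_univ _) (fun y => M - n * g y)
    (continuousOn_const.sub (continuousOn_const.mul hgc))
    ((harmOn_const M _).sub (hg.const_mul n)) (fun y hy => by
      by_cases hya : dist y a < ρ
      · rw [hbot y hya]
        exact bot_le
      · have hgy : g y = 0 := (hgs hy).trans (max_eq_left (by linarith))
        simpa [hgy] using hM y hy) x (mem_closedBall_self hR.le)
  refine h.trans_lt (EReal.coe_lt_coe_iff.2 ?_)
  rw [div_lt_iff₀ hgx] at hn
  linarith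

/-- The functions continuous on a closed ball and harmonic inside that dominate `u` on the
boundary sphere. -/
def harmMajorants (u : Euc d → EReal) (c : Euc d) (R : ℝ) : Set (Euc d → ℝ) :=
  {g | ContinuousOn g (closedBall c R) ∧ HarmOn g (ball c R) ∧ ∀ y ∈ sphere c R, u y ≤ g y}

open Classical in
/-- The Poisson modification of `u` in a ball. -/
def poissonMod (u : Euc d → EReal) (c : Euc d) (R : ℝ) (x : Euc d) : EReal :=
  if x ∈ closedBall c R then ⨅ g ∈ harmMajorants u c R, (g x : EReal) else u x

variable {c : Euc d} {R : ℝ}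

lemma poissonMod_le {g : Euc d → ℝ} (hg : g ∈ harmMajorants u c R) {x : Euc d}
    (hx : x ∈ closedBall c R) : poissonMod u c R x ≤ g x := by
  rw [poissonMod, if_pos hx]
  exact iInf₂_le g hg

lemma le_poissonMod (hu : SbhOn u univ) (hR : 0 < R) (x : Euc d) : u x ≤ poissonMod u c R x := by
  unfold poissonMod
  split_ifs with hx
  · exact le_iInf₂ fun g hg => hu.2.2 c R hR (subset_univ _) g hg.1 hg.2.1 hg.2.2 x hx
  · exact le_rfl

lemma exists_mem_harmMajorants_lt {x : Euc d} (hx : x ∈ closedBall c R) {t : EReal}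
    (ht : poissonMod u c R x < t) : ∃ g ∈ harmMajorants u c R, (g x : EReal) < t := by
  rw [poissonMod, if_pos hx] at ht
  simpa only [iInf_lt_iff, exists_prop] using ht

lemma const_mem_harmMajorants {M : ℝ} (hM : ∀ y ∈ sphere c R, u y ≤ M) :
    (fun _ => M) ∈ harmMajorants u c R :=
  ⟨continuousOn_const, harmOn_const M _, hM⟩

lemma exists_mem_harmMajorants_le (hd : d ≠ 0) (hR : 0 < R) {g₁ g₂ : Euc d → ℝ}
    (h₁ : g₁ ∈ harmMajorants u c R) (h₂ : g₂ ∈ harmMajorants u c R) :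
    ∃ g ∈ harmMajorants u c R, ∀ y ∈ closedBall c R, g y ≤ g₁ y ∧ g y ≤ g₂ y := by
  obtain ⟨g, hgc, hg, hgs⟩ := exists_harmOn_eqOn_sphere hd c hR (f := fun y => min (g₁ y) (g₂ y))
    ((h₁.1.mono sphere_subset_closedBall).inf (h₂.1.mono sphere_subset_closedBall))
  refine ⟨g, ⟨hgc, hg, fun y hy => ?_⟩, fun y hy => ⟨?_, ?_⟩⟩
  · rw [hgs hy, EReal.coe_strictMono.monotone.map_min]
    exact le_min (h₁.2.2 y hy) (h₂.2.2 y hy)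
  · simpa using HarmOn.le_of_le_sphere (M := 0) hd hgc hg h₁.1 h₁.2.1
      (fun z hz => by simp [hgs hz]) hy
  · simpa using HarmOn.le_of_le_sphere (M := 0) hd hgc hg h₂.1 h₂.2.1
      (fun z hz => by simp [hgs hz]) hy

lemma poissonMod_eq_of_notMem_ball (hd : d ≠ 0) (hu : SbhOn u univ) (hR : 0 < R) {x : Euc d}
    (hx : x ∉ ball c R) : poissonMod u c R x = u x := by
  by_cases hxc : x ∈ closedBall c R
  swap
  · rw [poissonMod, if_neg hxc]
  have hxs : x ∈ sphere c R := by
    rw [← closedBall_sdiff_ball]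
    exact ⟨hxc, hx⟩
  refine le_antisymm ((EReal.le_of_forall_lt_iff_le).1 fun t ht => ?_) (le_poissonMod hu hR x)
  obtain ⟨M, hM⟩ := hu.exists_forall_le (isCompact_sphere c R)
  have hnhds : ∀ᶠ y in 𝓝 x, u y < t := by
    simpa [nhdsWithin_univ] using hu.1 x (mem_univ x) t ht
  obtain ⟨ρ, hρ, hρt⟩ := Metric.eventually_nhds_iff.1 hnhds
  obtain ⟨g, hgc, hg, hgs⟩ := exists_harmOn_eqOn_sphere hd c hR
    (f := fun y => t + max (M - t) 0 * min 1 (dist y x / ρ)) (by fun_prop)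
  have hgx : g x = t := by simp [hgs hxs]
  rw [← hgx]
  refine poissonMod_le ⟨hgc, hg, fun y hy => ?_⟩ hxc
  rw [hgs hy]
  by_cases hyx : dist y x < ρ
  · refine (hρt hyx).le.trans (EReal.coe_le_coe_iff.2 ?_)
    have : 0 ≤ max (M - t) 0 * min 1 (dist y x / ρ) :=
      mul_nonneg (le_max_right _ _) (le_min zero_le_one (by positivity))
    linarith
  · refine (hM y hy).trans (EReal.coe_le_coe_iff.2 ?_)
    simp only [min_eq_left ((one_le_div hρ).2 (not_lt.1 hyx))]
    linarith [le_max_left (M - t) 0]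

lemma upperSemicontinuousOn_poissonMod (hu : SbhOn u univ) (hR : 0 < R) :
    UpperSemicontinuousOn (poissonMod u c R) univ := by
  intro x _ t ht
  rw [nhdsWithin_univ]
  have hut : ∀ᶠ y in 𝓝 x, u y < t := by
    simpa [nhdsWithin_univ] using hu.1 x (mem_univ x) t ((le_poissonMod hu hR x).trans_lt ht)
  by_cases hx : x ∈ closedBall c R
  · obtain ⟨g, hg, hgt⟩ := exists_mem_harmMajorants_lt hx ht
    have hgc : ContinuousWithinAt (fun y => (g y : EReal)) (closedBall c R) x :=
      continuous_coe_real_ereal.continuousAt.comp_continuousWithinAt (hg.1 x hx)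
    have hev := eventually_nhdsWithin_iff.1 (hgc.eventually (gt_mem_nhds hgt))
    filter_upwards [hut, hev] with y hy hgy
    by_cases hyc : y ∈ closedBall c R
    · exact (poissonMod_le hg hyc).trans_lt (hgy hyc)
    · rwa [poissonMod, if_neg hyc]
  · filter_upwards [hut, isClosed_closedBall.isOpen_compl.mem_nhds hx] with y hy hyc
    rwa [poissonMod, if_neg hyc]

lemma sbhOn_poissonMod (hd : d ≠ 0) (hu : SbhOn u univ) (hR : 0 < R) :
    SbhOn (poissonMod u c R) univ := by
  obtain ⟨M, hM⟩ := hu.exists_forall_le (isCompact_sphere c R)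
  refine ⟨upperSemicontinuousOn_poissonMod hu hR, fun x hx => ?_,
    fun x r hr _ h hc hh hbd y hy => ?_⟩
  · by_cases hxc : x ∈ closedBall c R
    · exact (poissonMod_le (const_mem_harmMajorants hM) hxc).trans_lt (EReal.coe_lt_top M)
    · rw [poissonMod, if_neg hxc]
      exact hu.2.1 x hx
  have huh := hu.2.2 x r hr (subset_univ _) h hc hh
    fun z hz => (le_poissonMod hu hR z).trans (hbd z hz)
  by_cases hyc : y ∈ closedBall c R
  swap
  · rw [poissonMod, if_neg hyc]
    exact huh y hy
  set K := closedBall c R ∩ closedBall x r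
  set W := ball c R ∩ ball x r
  have hK : IsCompact K := (isCompact_closedBall c R).inter_right isClosed_closedBall
  have hW : IsOpen W := isOpen_ball.inter isOpen_ball
  have hQ : ∀ z ∈ K \ W, poissonMod u c R z ≤ h z := by
    rintro z ⟨⟨hzc, hzx⟩, hzW⟩
    by_cases hzb : z ∈ ball c R
    · refine hbd z ?_
      rw [← closedBall_sdiff_ball]
      exact ⟨hzx, fun hz => hzW ⟨hzb, hz⟩⟩
    · rw [poissonMod_eq_of_notMem_ball hd hu hR hzb]
      exact huh z hzx
  refine (EReal.le_of_forall_lt_iff_le).1 fun t ht => ?_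
  have hlt_t : h y < t := EReal.coe_lt_coe_iff.1 ht
  obtain ⟨g, hg, hgQ⟩ : ∃ g ∈ harmMajorants u c R, ∀ z ∈ K \ W, z ∈ K \ W →
      g z - h z < t - h y := by
    refine (hK.diff hW).induction_on
      (p := fun S => ∃ g ∈ harmMajorants u c R, ∀ z ∈ S, z ∈ K \ W → g z - h z < t - h y)
      ⟨_, const_mem_harmMajorants hM, by simp⟩ ?_ ?_ ?_
    · rintro S T hST ⟨g, hg, hgT⟩
      exact ⟨g, hg, fun z hz => hgT z (hST hz)⟩
    · rintro S T ⟨g₁, hg₁, h₁⟩ ⟨g₂, hg₂, h₂⟩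
      obtain ⟨g, hg, hle⟩ := exists_mem_harmMajorants_le hd hR hg₁ hg₂
      refine ⟨g, hg, fun z hz hzQ => ?_⟩
      have := hle z hzQ.1.1
      rcases hz with hz | hz
      · linarith [h₁ z hz hzQ]
      · linarith [h₂ z hz hzQ]
    · intro z hz
      have hlt : poissonMod u c R z < ((h z + (t - h y) : ℝ) : EReal) :=
        (hQ z hz).trans_lt (EReal.coe_lt_coe_iff.2 (by linarith))
      obtain ⟨g, hg, hgz⟩ := exists_mem_harmMajorants_lt hz.1.1 hlt
      have hgz' : g z - h z < t - h y := by
        have := EReal.coe_lt_coe_iff.1 hgz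
        linarith
      have hcont : ContinuousWithinAt (fun w => g w - h w) (K \ W) z :=
        ((hg.1 z hz.1.1).mono fun w hw => hw.1.1).sub ((hc z hz.1.2).mono fun w hw => hw.1.2)
      refine ⟨_, inter_mem self_mem_nhdsWithin (hcont.eventually (gt_mem_nhds hgz')), g, hg,
        fun w hw _ => hw.2⟩
  have hle := HarmOn.le_of_le_boundary hd hK hW
    (inter_subset_inter ball_subset_closedBall ball_subset_closedBall)
    ((hg.1.mono inter_subset_left).sub (hc.mono inter_subset_right))
    ((hg.2.1.mono inter_subset_left).sub (hh.mono inter_subset_right))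
    (fun z hz => (hgQ z hz hz).le) (y := y) ⟨hyc, hy⟩
  exact (poissonMod_le hg hyc).trans (EReal.coe_le_coe_iff.2 ((sub_le_sub_iff_right _).1 hle))

lemma exists_le_poissonMod (hu : SbhOn u univ) (hne : ∃ x, u x ≠ ⊥) (hR : 0 < R) :
    ∃ C : ℝ, ∀ x ∈ ball c (R / 8), C ≤ poissonMod u c R x := by
  have hd := hu.dim_ne_zero hne
  obtain ⟨p, hp, hup⟩ := hu.exists_mem_ball_ne_bot hne c (ρ := R / 8) (by positivity)
  obtain ⟨M, hM⟩ := hu.exists_forall_le (isCompact_sphere c R)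
  have hsub : ball c (R / 8) ⊆ closedBall c R :=
    ball_subset_closedBall.trans (closedBall_subset_closedBall (by linarith))
  refine ⟨M - 2 ^ d * (M - (u p).toReal), fun x hx => ?_⟩
  rw [poissonMod, if_pos (hsub hx)]
  refine le_iInf₂ fun g₁ hg₁ => EReal.coe_le_coe_iff.2 ?_
  obtain ⟨g, hg, hle⟩ := exists_mem_harmMajorants_le hd hR hg₁ (const_mem_harmMajorants hM)
  have hpg : (u p).toReal ≤ g p := by
    have := hu.2.2 c R hR (subset_univ _) g hg.1 hg.2.1 hg.2.2 p (hsub hp)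
    rw [← EReal.coe_toReal (hu.2.1 p (mem_univ p)).ne hup] at this
    exact EReal.coe_le_coe_iff.1 this
  have hharnack := HarmOn.harnack hR ((harmOn_const M _).sub hg.2.1)
    (fun y hy => sub_nonneg.2 (hle y (ball_subset_closedBall hy)).2) hx hp
  have h1 := (hle x (hsub hx)).1
  have h2 : (2 : ℝ) ^ d * (M - g p) ≤ 2 ^ d * (M - (u p).toReal) := by gcongr
  linarith

/-- A subharmonic function can be made bounded below near finitely many points by modifying it
only in small balls around them. -/
lemma SbhOn.exists_bddBelow_modification (hu : SbhOn u univ) (hne : ∃ x, u x ≠ ⊥) {ρ : ℝ}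
    (hρ : 0 < ρ) (T : Finset (Euc d)) :
    ∃ v : Euc d → EReal, SbhOn v univ ∧ (∀ x, u x ≤ v x) ∧
      (∀ x, (∀ z ∈ T, x ∉ ball z ρ) → v x = u x) ∧
      ∃ C : ℝ, ∀ x, ∀ z ∈ T, x ∈ ball z (ρ / 8) → C ≤ v x := by
  classical
  have hd := hu.dim_ne_zero hne
  induction T using Finset.induction_on with
  | empty => exact ⟨u, hu, fun _ => le_rfl, fun _ _ => rfl, 0, by simp⟩
  | insert z T _ ih =>
    obtain ⟨v, hv, huv, hvu, C, hC⟩ := ih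
    have hvne : ∃ x, v x ≠ ⊥ := by
      obtain ⟨x, hx⟩ := hne
      exact ⟨x, fun h => hx (le_bot_iff.1 (h ▸ huv x))⟩
    obtain ⟨C', hC'⟩ := exists_le_poissonMod (c := z) hv hvne hρ
    refine ⟨poissonMod v z ρ, sbhOn_poissonMod hd hv hρ,
      fun x => (huv x).trans (le_poissonMod hv hρ x), fun x hx => ?_, min C C', fun x w hw hxw => ?_⟩
    · rw [poissonMod_eq_of_notMem_ball hd hv hρ (hx z (Finset.mem_insert_self z T))]
      exact hvu x fun w hw => hx w (Finset.mem_insert_of_mem hw)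
    · rw [EReal.coe_strictMono.monotone.map_min]
      rcases Finset.mem_insert.1 hw with rfl | hw
      · exact (min_le_right _ _).trans (hC' x hxw)
      · exact (min_le_left _ _).trans ((hC x w hw hxw).trans (le_poissonMod hv hρ x))

end Subharmonic

section Balayage

variable {d : ℕ}

lemma isClosed_msupp (μ : Measure (Euc d)) : IsClosed (msupp μ) := by
  refine isOpen_compl_iff.1 (isOpen_iff_mem_nhds.2 fun x hx => ?_)
  simp only [msupp, mem_compl_iff, mem_ofPred_eq, not_forall] at hx
  obtain ⟨U, hU, hxU, hμ⟩ := hx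
  filter_upwards [hU.mem_nhds hxU] with y hy hys
  exact hμ (hys U hU hy)

lemma bot_lt_eInt {μ : Measure (Euc d)} {v : Euc d → EReal} {C : ℝ} (hμ : μ univ < ⊤)
    (hC : ∀ᵐ x ∂μ, (C : EReal) ≤ v x) : ⊥ < eInt μ v := by
  have hfin : ∫⁻ x, erealPos (-(v x)) ∂μ ≠ ⊤ := by
    refine ((lintegral_mono_ae (g := fun _ => ENNReal.ofReal (-C)) ?_).trans_lt ?_).ne
    · filter_upwards [hC] with x hx
      have hle : -(v x) ≤ ((-C : ℝ) : EReal) := by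
        rw [EReal.coe_neg]
        exact EReal.neg_le_neg_iff.2 hx
      have hne : -(v x) ≠ ⊤ := (hle.trans_lt (EReal.coe_lt_top _)).ne
      rw [erealPos, if_neg hne]
      by_cases hb : -(v x) = ⊥
      · simp [hb]
      · exact ENNReal.ofReal_le_ofReal (EReal.toReal_le_toReal hle hb (EReal.coe_ne_top _))
    · rw [lintegral_const]
      exact ENNReal.mul_lt_top ENNReal.ofReal_lt_top hμ
  rw [eInt, bot_lt_iff_ne_bot, Ne, sub_eq_add_neg, EReal.add_eq_bot_iff, not_or]
  refine ⟨EReal.coe_ennreal_ne_bot _, fun h => hfin ?_⟩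
  rwa [EReal.neg_eq_bot_iff, EReal.coe_ennreal_eq_top_iff] at h

lemma measure_bot_eq_zero_of_bot_lt_eInt {μ : Measure (Euc d)} {v : Euc d → EReal}
    (hv : UpperSemicontinuousOn v univ) (h : ⊥ < eInt μ v) : μ {x | v x = ⊥} = 0 := by
  by_contra hpos
  have hmeas : MeasurableSet {x | v x = ⊥} :=
    (upperSemicontinuousOn_univ_iff.1 hv).measurable (measurableSet_singleton ⊥)
  have htop : ∫⁻ x, erealPos (-(v x)) ∂μ = ⊤ := by
    refine top_le_iff.1 ?_
    calc (⊤ : ℝ≥0∞) = ∫⁻ _ in {x | v x = ⊥}, ⊤ ∂μ := by simp [ENNReal.top_mul hpos]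
      _ = ∫⁻ x in {x | v x = ⊥}, erealPos (-(v x)) ∂μ :=
        setLIntegral_congr_fun hmeas fun x hx => by
          rw [mem_ofPred_eq] at hx
          simp [hx, erealPos]
      _ ≤ _ := setLIntegral_le_lintegral _ _
  rw [eInt, htop] at h
  simp at h

end Balayage

/-- If `ω` is an `sbh(O)`-balayage of `δ` (both finite positive Borel
measures with compact support in the open set `O ⊆ ℝ^d`) and `E ⊆ ℝ^d` is polar, then
`ω (O ∩ E \ supp δ) = 0`. -/
theorem stmt_14 {d : ℕ} (O : Set (Euc d)) (hO : IsOpen O) (hOne : O.Nonempty)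
    (δ ω : Measure (Euc d)) (hδ : MeasCompIn δ O) (hω : MeasCompIn ω O)
    (hbal : ∀ u : Euc d → EReal, SbhOn u O → eInt δ u ≤ eInt ω u)
    (E : Set (Euc d)) (hE : PolarSet E) :
    ω ((O ∩ E) \ msupp δ) = 0 := by
  obtain ⟨u, hu, hne, hEu⟩ := hE
  refine measure_null_of_locally_null _ fun x₀ hx₀ => ?_
  obtain ⟨r, hr, hsub⟩ := Metric.isOpen_iff.1 (isClosed_msupp δ).isOpen_compl x₀ hx₀.2
  have hρ : 0 < r / 2 := half_pos hr
  obtain ⟨T, hT, hcover⟩ := hδ.1.elim_nhds_subcover (fun z => ball z (r / 2 / 8))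
    fun z _ => ball_mem_nhds z (by positivity)
  obtain ⟨v, hv, _, hvu, C, hC⟩ := hu.exists_bddBelow_modification hne hρ T
  have hδv : ⊥ < eInt δ v := by
    refine bot_lt_eInt (C := C) hδ.2.2.2 ?_
    have : ∀ᵐ x ∂δ, x ∈ msupp δ := hδ.2.2.1
    filter_upwards [this] with x hx
    obtain ⟨z, hz, hxz⟩ := mem_iUnion₂.1 (hcover hx)
    exact hC x z hz hxz
  have hωv := measure_bot_eq_zero_of_bot_lt_eInt hv.1
    (hδv.trans_le (hbal v (hv.mono (subset_univ O))))
  refine ⟨((O ∩ E) \ msupp δ) ∩ ball x₀ (r / 2),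
    inter_mem self_mem_nhdsWithin (mem_nhdsWithin_of_mem_nhds (ball_mem_nhds x₀ hρ)),
    measure_mono_null ?_ hωv⟩
  rintro x ⟨hx, hxb⟩
  refine (hvu x fun z hz hxz => absurd (hT z hz) (hsub (a := z) ?_)).trans (hEu hx.1.2)
  rw [mem_ball] at hxb hxz ⊢
  linarith [dist_triangle_left z x₀ x]
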